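/- Let G be the Artin group of a spherical type Coxeter matrix over S, and let X ⊆ S. Then the standard parabolic subgroup G_X intersected with the Artin monoid G⁺ (viewed inside G) equals the submonoid G_X⁺ generated by X. -/

import Mathlib

def altFree {B : Type*} (s t : B) (m : ℕ) : FreeGroup B :=
  (List.map FreeGroup.of (CoxeterSystem.alternatingWord s t m)).prod

def artinRels {B : Type*} (M : CoxeterMatrix B) : Set (FreeGroup B) :=
  {r | ∃ s t : B, s ≠ t ∧ M s t ≠ 0 ∧
    r = altFree s t (M s t) * (altFree t s (M s t))⁻¹}

abbrev ArtinGroup {B : Type*} (M : CoxeterMatrix B) : Type _ :=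
  PresentedGroup (artinRels M)

def agen {B : Type*} (M : CoxeterMatrix B) (s : B) : ArtinGroup M :=
  PresentedGroup.of s

def braidRel {B : Type*} (M : CoxeterMatrix B) : FreeMonoid B → FreeMonoid B → Prop :=
  fun a b => ∃ s t : B, s ≠ t ∧ M s t ≠ 0 ∧
    a = FreeMonoid.ofList (CoxeterSystem.alternatingWord s t (M s t)) ∧
    b = FreeMonoid.ofList (CoxeterSystem.alternatingWord t s (M s t))

def artinCon {B : Type*} (M : CoxeterMatrix B) : Con (FreeMonoid B) :=
  conGen (braidRel M)

abbrev ArtinMonoid {B : Type*} (M : CoxeterMatrix B) : Type _ :=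
  (artinCon M).Quotient

/-- The coefficients of the roots of a dihedral group in the basis of simple roots: Chebyshev
polynomials of the second kind evaluated at `a / 2`. -/
def dihedralCoeff (a : ℝ) : ℕ → ℝ
  | 0 => 0
  | 1 => 1
  | n + 2 => a * dihedralCoeff a (n + 1) - dihedralCoeff a n

theorem sin_mul_dihedralCoeff (θ : ℝ) (n : ℕ) :
    Real.sin θ * dihedralCoeff (2 * Real.cos θ) n = Real.sin (n * θ) := by
  induction n using Nat.twoStepInduction with
  | zero => simp [dihedralCoeff]
  | one => simp [dihedralCoeff]
  | more n ih₀ ih₁ =>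
    rw [dihedralCoeff, mul_sub, mul_left_comm, ih₁, ih₀]
    push_cast
    rw [show ((n : ℝ) + 2) * θ = (n + 1) * θ + θ by ring,
      show (n : ℝ) * θ = (n + 1) * θ - θ by ring, Real.sin_add, Real.sin_sub]
    ring

theorem dihedralCoeff_two (n : ℕ) : dihedralCoeff 2 n = n := by
  induction n using Nat.twoStepInduction with
  | zero => simp [dihedralCoeff]
  | one => simp [dihedralCoeff]
  | more n ih₀ ih₁ =>
    rw [dihedralCoeff, ih₁, ih₀]
    push_cast
    ring

theorem sin_pi_div_pos {m : ℕ} (hm : 2 ≤ m) : 0 < Real.sin (Real.pi / m) := by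
  have hm' : (2 : ℝ) ≤ m := by exact_mod_cast hm
  apply Real.sin_pos_of_pos_of_lt_pi
  · have := Real.pi_pos
    positivity
  · exact div_lt_self Real.pi_pos (by linarith)

theorem dihedralCoeff_nonneg {m k : ℕ} (hm : m ≠ 1) (hk : m ≠ 0 → k ≤ m) :
    0 ≤ dihedralCoeff (2 * Real.cos (Real.pi / m)) k := by
  rcases Nat.eq_zero_or_pos m with rfl | hpos
  · simp [dihedralCoeff_two]
  · have hm' : (0 : ℝ) < m := by exact_mod_cast hpos
    have hs := sin_pi_div_pos (m := m) (by lia)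
    refine nonneg_of_mul_nonneg_right ?_ hs
    rw [sin_mul_dihedralCoeff]
    have := Real.pi_pos
    apply Real.sin_nonneg_of_nonneg_of_le_pi
    · positivity
    · have hk' : (k : ℝ) ≤ m := by exact_mod_cast hk hpos.ne'
      rw [mul_div_assoc', div_le_iff₀ hm', mul_comm]
      gcongr

theorem dihedralCoeff_sub {m k : ℕ} (hm : 2 ≤ m) (hk : k ≤ m) :
    dihedralCoeff (2 * Real.cos (Real.pi / m)) (m - k) =
      dihedralCoeff (2 * Real.cos (Real.pi / m)) k := by
  have hs := sin_pi_div_pos hm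
  have hm' : (m : ℝ) ≠ 0 := by exact_mod_cast (by lia : m ≠ 0)
  apply mul_left_cancel₀ hs.ne'
  rw [sin_mul_dihedralCoeff, sin_mul_dihedralCoeff, Nat.cast_sub hk, sub_mul,
    mul_div_cancel₀ _ hm', Real.sin_pi_sub]

theorem dihedralCoeff_two_mul {m : ℕ} (hm : 2 ≤ m) :
    dihedralCoeff (2 * Real.cos (Real.pi / m)) (2 * m) = 0 := by
  have hs := sin_pi_div_pos hm
  have hm' : (m : ℝ) ≠ 0 := by exact_mod_cast (by lia : m ≠ 0)
  apply mul_left_cancel₀ hs.ne'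
  rw [sin_mul_dihedralCoeff, mul_zero]
  push_cast
  rw [mul_assoc, mul_div_cancel₀ _ hm', Real.sin_two_pi]

theorem dihedralCoeff_two_mul_add_one {m : ℕ} (hm : 2 ≤ m) :
    dihedralCoeff (2 * Real.cos (Real.pi / m)) (2 * m + 1) = 1 := by
  have hs := sin_pi_div_pos hm
  have hm' : (m : ℝ) ≠ 0 := by exact_mod_cast (by lia : m ≠ 0)
  apply mul_left_cancel₀ hs.ne'
  rw [sin_mul_dihedralCoeff]
  push_cast
  rw [add_mul, mul_assoc, mul_div_cancel₀ _ hm', add_comm, one_mul, Real.sin_add_two_pi, mul_one]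

namespace CoxeterMatrix

open CoxeterSystem Module

section Coefficients

variable {B : Type*} (M : CoxeterMatrix B)

/-- The coefficients relevant for the dihedral subgroup generated by `s` and `t`. -/
noncomputable abbrev coeff (s t : B) (k : ℕ) : ℝ :=
  dihedralCoeff (2 * Real.cos (Real.pi / M s t)) k

theorem coeff_comm (s t : B) (k : ℕ) : M.coeff s t k = M.coeff t s k := by
  rw [coeff, M.symmetric]

theorem coeff_nonneg {s t : B} (h : s ≠ t) {k : ℕ} (hk : M s t ≠ 0 → k ≤ M s t) :
    0 ≤ M.coeff s t k :=
  dihedralCoeff_nonneg (M.off_diagonal s t h) hk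

end Coefficients

section SimpleRoots

variable {B : Type*} [DecidableEq B]

/-- The simple root attached to `s`. -/
def simpleRoot (s : B) : B → ℝ := Pi.single s 1

theorem simpleRoot_apply_self (s : B) : simpleRoot s s = 1 := by simp [simpleRoot]

theorem simpleRoot_apply_of_ne {s t : B} (h : t ≠ s) : simpleRoot s t = 0 := by
  simp [simpleRoot, h]

theorem simpleRoot_ne_zero (s : B) : simpleRoot s ≠ 0 := by simp [simpleRoot]

theorem simpleRoot_nonneg (s : B) : 0 ≤ simpleRoot s := by simp [simpleRoot]

theorem simpleRoot_injective : Function.Injective (simpleRoot : B → B → ℝ) := by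
  intro s t h
  by_contra hst
  have := congrFun h s
  rw [simpleRoot_apply_self, simpleRoot_apply_of_ne hst] at this
  exact one_ne_zero this

/-- The root `c₀ c₁ ⋯ cₖ₋₁ αₖ`, where `c₀ = t, c₁ = s, …` alternate and `αₖ` is the simple root
of `cₖ`. -/
noncomputable def altRoot (M : CoxeterMatrix B) (s t : B) (k : ℕ) : B → ℝ :=
  M.coeff s t (k + 1) • simpleRoot t + M.coeff s t k • simpleRoot s

theorem altRoot_nonneg (M : CoxeterMatrix B) {s t : B} (hst : s ≠ t) {k : ℕ} (hk : k < M s t) :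
    0 ≤ M.altRoot s t k :=
  add_nonneg (smul_nonneg (M.coeff_nonneg hst fun _ => hk) (simpleRoot_nonneg t))
    (smul_nonneg (M.coeff_nonneg hst fun _ => hk.le) (simpleRoot_nonneg s))

theorem altRoot_sub (M : CoxeterMatrix B) {s t : B} (hst : s ≠ t) {k : ℕ} (hk : k < M s t) :
    M.altRoot t s (M s t - 1 - k) = M.altRoot s t k := by
  have h2 : 2 ≤ M s t := by have := M.off_diagonal s t hst; lia
  rw [altRoot, altRoot, M.coeff_comm t s, M.coeff_comm t s,
    show M s t - 1 - k + 1 = M s t - k by lia, show M s t - 1 - k = M s t - (k + 1) by lia,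
    coeff, coeff, dihedralCoeff_sub h2 hk.le, dihedralCoeff_sub h2 hk, add_comm]

end SimpleRoots

section GeometricRepresentation

variable {B : Type*} [Fintype B] [DecidableEq B] (M : CoxeterMatrix B)

/-- The symmetric bilinear form of a Coxeter matrix `M`, with entries `-cos (π / M i j)`
(and `-1` when `M i j = 0`). -/
noncomputable def cosForm : LinearMap.BilinForm ℝ (B → ℝ) :=
  Matrix.toBilin' (Matrix.of fun i j => -Real.cos (Real.pi / M i j))

theorem cosForm_simpleRoot (s t : B) :
    M.cosForm (simpleRoot s) (simpleRoot t) = -Real.cos (Real.pi / M s t) := by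
  simp [cosForm, simpleRoot, Matrix.toBilin'_single]

theorem cosForm_simpleRoot_self (s : B) : M.cosForm (simpleRoot s) (simpleRoot s) = 1 := by
  simp [cosForm_simpleRoot]

theorem cosForm_comm (v w : B → ℝ) : M.cosForm v w = M.cosForm w v := by
  simp only [cosForm, Matrix.toBilin'_apply, Matrix.of_apply]
  rw [Finset.sum_comm]
  refine Finset.sum_congr rfl fun i _ => Finset.sum_congr rfl fun j _ => ?_
  rw [M.symmetric]
  ring

/-- The reflection of the geometric representation attached to `s`. -/
noncomputable def simpleReflection (s : B) : (B → ℝ) ≃ₗ[ℝ] (B → ℝ) :=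
  Module.reflection (x := simpleRoot s) (f := (2 : ℝ) • M.cosForm (simpleRoot s))
    (by simp [cosForm_simpleRoot_self])

theorem simpleReflection_apply (s : B) (v : B → ℝ) :
    M.simpleReflection s v = v - (2 * M.cosForm (simpleRoot s) v) • simpleRoot s := by
  simp [simpleReflection, Module.reflection_apply]

theorem simpleReflection_apply_self (s : B) :
    M.simpleReflection s (simpleRoot s) = -simpleRoot s := by
  simp [simpleReflection, Module.reflection_apply_self]

theorem simpleReflection_apply_simpleRoot (s t : B) :
    M.simpleReflection s (simpleRoot t) =
      simpleRoot t + (2 * Real.cos (Real.pi / M s t)) • simpleRoot s := by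
  rw [simpleReflection_apply, cosForm_simpleRoot, mul_neg, neg_smul, sub_neg_eq_add]

theorem simpleReflection_mul_self (s : B) : M.simpleReflection s * M.simpleReflection s = 1 := by
  ext1 v
  exact Module.involutive_reflection _ v

theorem cosForm_simpleReflection (s : B) (v w : B → ℝ) :
    M.cosForm (M.simpleReflection s v) (M.simpleReflection s w) = M.cosForm v w := by
  simp only [simpleReflection_apply, map_sub, map_smul, LinearMap.sub_apply, LinearMap.smul_apply,
    smul_eq_mul, cosForm_simpleRoot_self, M.cosForm_comm v (simpleRoot s)]
  ring

/-- The product of the reflections along an alternating word. -/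
noncomputable def altReflection (s t : B) (k : ℕ) : (B → ℝ) ≃ₗ[ℝ] (B → ℝ) :=
  ((alternatingWord s t k).map M.simpleReflection).prod

theorem altReflection_zero (s t : B) : M.altReflection s t 0 = 1 := rfl

theorem altReflection_succ (s t : B) (k : ℕ) :
    M.altReflection s t (k + 1) = M.altReflection t s k * M.simpleReflection t := by
  simp [altReflection, alternatingWord_succ]

theorem altReflection_succ' (s t : B) (k : ℕ) :
    M.altReflection s t (k + 1) =
      M.simpleReflection (if Even k then t else s) * M.altReflection s t k := by
  simp [altReflection, alternatingWord_succ']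

theorem altReflection_two_mul (s t : B) (k : ℕ) :
    M.altReflection s t (2 * k) = (M.simpleReflection s * M.simpleReflection t) ^ k := by
  induction k with
  | zero => rfl
  | succ k ih =>
    rw [mul_add, mul_one, altReflection_succ, altReflection_succ, ih, pow_succ, mul_assoc]

theorem altReflection_altRoot (s t : B) (k : ℕ) :
    M.altReflection s t k (M.altRoot s t k) = simpleRoot (if Even k then t else s) := by
  induction k generalizing s t with
  | zero => simp [altReflection_zero, altRoot, dihedralCoeff]
  | succ k ih =>
    have h : M.simpleReflection t (M.altRoot s t (k + 1)) = M.altRoot t s k := by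
      simp only [altRoot, map_add, map_smul, simpleReflection_apply_self,
        simpleReflection_apply_simpleRoot, M.coeff_comm t s, M.symmetric t s]
      rw [coeff, dihedralCoeff]
      module
    rw [altReflection_succ, LinearEquiv.mul_apply, h, ih]
    simp only [Nat.even_add_one]
    split_ifs <;> rfl

theorem altReflection_simpleRoot (s t : B) (k : ℕ) :
    M.altReflection s t k (simpleRoot s) =
      M.coeff s t (k + 1) • simpleRoot (if Even k then s else t) +
        M.coeff s t k • simpleRoot (if Even k then t else s) := by
  induction k with
  | zero => simp [altReflection_zero, dihedralCoeff]
  | succ k ih =>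
    rw [altReflection_succ', LinearEquiv.mul_apply, ih]
    by_cases hk : Even k
    · simp only [hk, Nat.even_add_one, not_true, if_true, if_false, map_add, map_smul,
        simpleReflection_apply_self, simpleReflection_apply_simpleRoot, M.symmetric t s]
      simp only [coeff, dihedralCoeff]
      module
    · simp only [hk, Nat.even_add_one, not_false_iff, if_true, if_false, map_add, map_smul,
        simpleReflection_apply_self, simpleReflection_apply_simpleRoot]
      simp only [coeff, dihedralCoeff]
      module

theorem simpleReflection_mul_pow_simpleRoot {s t : B} (h : 2 ≤ M s t) :
    ((M.simpleReflection s * M.simpleReflection t) ^ M s t) (simpleRoot s) = simpleRoot s := by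
  rw [← altReflection_two_mul, altReflection_simpleRoot]
  simp [dihedralCoeff_two_mul h, dihedralCoeff_two_mul_add_one h]

theorem isLiftable_simpleReflection : M.IsLiftable M.simpleReflection := by
  intro s t
  by_cases hst : s = t
  · simp [hst, simpleReflection_mul_self]
  rcases Nat.eq_zero_or_pos (M s t) with h0 | hpos
  · simp [h0]
  have h2 : 2 ≤ M s t := by have := M.off_diagonal s t hst; lia
  set τ := (M.simpleReflection s * M.simpleReflection t) ^ M s t with hτ
  have hs : τ (simpleRoot s) = simpleRoot s := M.simpleReflection_mul_pow_simpleRoot h2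
  have ht : τ (simpleRoot t) = simpleRoot t := by
    have h := M.simpleReflection_mul_pow_simpleRoot (s := t) (t := s) (by rwa [M.symmetric])
    have hinv : τ * (M.simpleReflection t * M.simpleReflection s) ^ M t s = 1 := by
      have hi (s : B) : M.simpleReflection s = (M.simpleReflection s)⁻¹ :=
        eq_inv_of_mul_eq_one_left (M.simpleReflection_mul_self s)
      rw [hi t, hi s, ← mul_inv_rev, inv_pow, M.symmetric t s, hτ, mul_inv_cancel]
    rw [← h, ← LinearEquiv.mul_apply, hinv, h]
    rfl
  have hfix (v : B → ℝ) (h₁ : M.cosForm (simpleRoot s) v = 0)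
      (h₂ : M.cosForm (simpleRoot t) v = 0) : τ v = v := by
    have (n : ℕ) : ((M.simpleReflection s * M.simpleReflection t) ^ n) v = v := by
      induction n with
      | zero => rfl
      | succ n ih =>
        rw [pow_succ, LinearEquiv.mul_apply, LinearEquiv.mul_apply]
        simp [simpleReflection_apply, h₁, h₂, ih]
    exact this _
  ext1 v
  have hc : (1 : ℝ) - Real.cos (Real.pi / M s t) ^ 2 ≠ 0 := by
    have := (sin_pi_div_pos h2).ne'
    have h := Real.sin_sq_add_cos_sq (Real.pi / M s t)
    intro h'
    exact this (by nlinarith)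
  set c := Real.cos (Real.pi / M s t)
  set b := M.cosForm (simpleRoot s) v with hb
  set d := M.cosForm (simpleRoot t) v with hd
  have hv : v = (v - ((b + c * d) / (1 - c ^ 2)) • simpleRoot s
      - ((d + c * b) / (1 - c ^ 2)) • simpleRoot t)
      + (((b + c * d) / (1 - c ^ 2)) • simpleRoot s
      + ((d + c * b) / (1 - c ^ 2)) • simpleRoot t) := by
    module
  rw [LinearEquiv.coe_one, id, hv, map_add, map_add, map_smul, map_smul, hs, ht, hfix]
  · simp only [map_sub, map_smul, cosForm_simpleRoot, smul_eq_mul, diagonal, Nat.cast_one, div_one,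
      Real.cos_pi, neg_neg, mul_one, ← hb]
    change b - _ - _ * -c = 0
    field_simp
    ring
  · simp only [map_sub, map_smul, cosForm_simpleRoot, smul_eq_mul, diagonal, Nat.cast_one, div_one,
      Real.cos_pi, neg_neg, mul_one, ← hd, M.symmetric t s]
    change d - _ * -c - _ = 0
    field_simp
    ring

/-- The geometric representation of the Coxeter group. -/
noncomputable def geomRep : M.Group →* ((B → ℝ) ≃ₗ[ℝ] (B → ℝ)) :=
  M.toCoxeterSystem.lift ⟨M.simpleReflection, M.isLiftable_simpleReflection⟩

theorem geomRep_simple (s : B) :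
    M.geomRep (M.toCoxeterSystem.simple s) = M.simpleReflection s :=
  M.toCoxeterSystem.lift_apply_simple M.isLiftable_simpleReflection s

theorem geomRep_alternatingWord (s t : B) (k : ℕ) :
    M.geomRep (M.toCoxeterSystem.wordProd (alternatingWord s t k)) = M.altReflection s t k := by
  simp [wordProd, map_list_prod, altReflection, Function.comp_def, geomRep_simple,
    -toCoxeterSystem_simple]

theorem altReflection_comm (s t : B) :
    M.altReflection s t (M s t) = M.altReflection t s (M s t) := by
  have h := M.toCoxeterSystem.wordProd_braidWord_eq s t
  rw [braidWord, braidWord, M.symmetric t s] at h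
  rw [← geomRep_alternatingWord, ← geomRep_alternatingWord, h]

theorem simpleReflection_mem_range (s : B) : M.simpleReflection s ∈ M.geomRep.range :=
  ⟨_, M.geomRep_simple s⟩

theorem cosForm_apply_of_mem_range {f : (B → ℝ) ≃ₗ[ℝ] (B → ℝ)} (hf : f ∈ M.geomRep.range)
    (v w : B → ℝ) : M.cosForm (f v) (f w) = M.cosForm v w := by
  obtain ⟨u, rfl⟩ := hf
  induction u using M.toCoxeterSystem.simple_induction_left with
  | one => simp
  | mul_simple_left u i ih =>
    rw [map_mul, geomRep_simple, LinearEquiv.mul_apply, LinearEquiv.mul_apply,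
      cosForm_simpleReflection, ih]

theorem cosForm_smul_smul (c : ℝ) (s : B) :
    M.cosForm (c • simpleRoot s) (c • simpleRoot s) = c ^ 2 := by
  simp only [map_smul, LinearMap.smul_apply, smul_eq_mul, cosForm_simpleRoot_self]
  ring

theorem geomRep_simpleRoot_nonneg_of_not_isRightDescent (w : M.Group) (s : B)
    (hs : ¬ M.toCoxeterSystem.IsRightDescent w s) : 0 ≤ M.geomRep w (simpleRoot s) := by
  set cs := M.toCoxeterSystem
  induction hn : cs.length w using Nat.strong_induction_on generalizing w s with
  | _ n ih =>
  by_cases hw : w = 1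
  · simpa [hw] using simpleRoot_nonneg s
  obtain ⟨t, ht⟩ := cs.exists_rightDescent_of_ne_one hw
  have hst : s ≠ t := fun h => hs (h ▸ ht)
  let P (k : ℕ) : Prop :=
    ∃ v, w = v * cs.wordProd (alternatingWord s t k) ∧ cs.length w = cs.length v + k
  have hP1 : P 1 := by
    refine ⟨w * cs.simple t, ?_, (cs.isRightDescent_iff.mp ht).symm⟩
    simp [alternatingWord, wordProd]
  obtain ⟨k, hk1, ⟨v, hwv, hlen⟩, hk⟩ : ∃ k, 1 ≤ k ∧ P k ∧ ¬ P (k + 1) := by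
    by_contra! hcon
    have hall (k : ℕ) (hk : 1 ≤ k) : P k := by
      induction k, hk using Nat.le_induction with
      | base => exact hP1
      | succ k hk ih => exact hcon k hk ih
    obtain ⟨v, -, hv⟩ := hall (cs.length w + 1) (by lia)
    lia
  have hnext : ¬ cs.IsRightDescent v (if Even k then t else s) := by
    intro hd
    refine hk ⟨v * cs.simple (if Even k then t else s), ?_, ?_⟩
    · rw [alternatingWord_succ', wordProd_cons, ← mul_assoc, simple_mul_simple_cancel_right, hwv]
    · rw [hlen, ← cs.isRightDescent_iff.mp hd]
      ring
  have hprev : ¬ cs.IsRightDescent v (if Even k then s else t) := by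
    obtain ⟨j, rfl⟩ : ∃ j, k = j + 1 := ⟨k - 1, by lia⟩
    have hsw : (if Even (j + 1) then s else t) = if Even j then t else s := by
      simp only [Nat.even_add_one]
      split_ifs <;> rfl
    rw [hsw]
    intro hd
    rw [alternatingWord_succ', wordProd_cons, ← mul_assoc] at hwv
    have h₁ := cs.length_mul_le (v * cs.simple (if Even j then t else s))
      (cs.wordProd (alternatingWord s t j))
    have h₂ := cs.length_wordProd_le (alternatingWord s t j)
    rw [length_alternatingWord] at h₂
    rw [← hwv] at h₁
    have h₃ := cs.isRightDescent_iff.mp hd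
    lia
  have hkm : M s t ≠ 0 → k + 1 ≤ M s t := by
    intro hm
    by_contra! hlt
    rcases (Nat.lt_succ_iff.mp hlt).eq_or_lt with hkm | hkm
    · have hbraid := cs.wordProd_braidWord_eq s t
      rw [braidWord, braidWord, M.symmetric t s, hkm] at hbraid
      obtain ⟨j, rfl⟩ : ∃ j, k = j + 1 := ⟨k - 1, by lia⟩
      rw [hbraid, alternatingWord_succ, wordProd_concat, ← mul_assoc] at hwv
      have h₁ := cs.length_mul_le v (cs.wordProd (alternatingWord s t j))
      have h₂ := cs.length_wordProd_le (alternatingWord s t j)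
      rw [length_alternatingWord] at h₂
      have h₃ : w * cs.simple s = v * cs.wordProd (alternatingWord s t j) := by
        rw [hwv, simple_mul_simple_cancel_right]
      apply hs
      rw [IsRightDescent, h₃]
      lia
    · have h₁ := cs.length_wordProd_le (alternatingWord s t k)
      have h₂ : cs.length (cs.wordProd (alternatingWord s t k)) ≠ _ :=
        cs.not_isReduced_alternatingWord s t hm hkm
      have h₃ := cs.length_mul_le v (cs.wordProd (alternatingWord s t k))
      rw [length_alternatingWord] at h₁ h₂
      rw [← hwv] at h₃
      lia
  rw [hwv, map_mul, geomRep_alternatingWord, LinearEquiv.mul_apply, altReflection_simpleRoot,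
    map_add, map_smul, map_smul]
  exact add_nonneg
    (smul_nonneg (M.coeff_nonneg hst hkm) (ih _ (by lia) v _ hprev rfl))
    (smul_nonneg (M.coeff_nonneg hst fun h => (Nat.le_succ k).trans (hkm h))
      (ih _ (by lia) v _ hnext rfl))

variable {M}

theorem nonneg_or_nonpos_of_mem_range {f : (B → ℝ) ≃ₗ[ℝ] (B → ℝ)} (hf : f ∈ M.geomRep.range)
    (s : B) : 0 ≤ f (simpleRoot s) ∨ f (simpleRoot s) ≤ 0 := by
  obtain ⟨w, rfl⟩ := hf
  by_cases hs : M.toCoxeterSystem.IsRightDescent w s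
  · right
    have h := M.geomRep_simpleRoot_nonneg_of_not_isRightDescent _ s
      (M.toCoxeterSystem.isRightDescent_iff_not_isRightDescent_mul.mp hs)
    rw [map_mul, geomRep_simple, LinearEquiv.mul_apply, simpleReflection_apply_self, map_neg] at h
    exact neg_nonneg.mp h
  · exact .inl (M.geomRep_simpleRoot_nonneg_of_not_isRightDescent w s hs)

theorem eq_simpleRoot_of_eq_smul {f : (B → ℝ) ≃ₗ[ℝ] (B → ℝ)} (hf : f ∈ M.geomRep.range)
    {x s : B} {c : ℝ} (hc : 0 ≤ c) (h : f (simpleRoot x) = c • simpleRoot s) :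
    f (simpleRoot x) = simpleRoot s := by
  have h1 := M.cosForm_apply_of_mem_range hf (simpleRoot x) (simpleRoot x)
  rw [h, cosForm_smul_smul, cosForm_simpleRoot_self, pow_eq_one_iff_of_nonneg hc two_ne_zero] at h1
  rw [h, h1, one_smul]

theorem simpleReflection_nonneg {f : (B → ℝ) ≃ₗ[ℝ] (B → ℝ)} (hf : f ∈ M.geomRep.range)
    {x s : B} (hx : 0 ≤ f (simpleRoot x)) (hne : f (simpleRoot x) ≠ simpleRoot s) :
    0 ≤ M.simpleReflection s (f (simpleRoot x)) := by
  have hsf := mul_mem (M.simpleReflection_mem_range s) hf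
  refine (nonneg_or_nonpos_of_mem_range hsf x).resolve_right fun hneg => hne ?_
  rw [LinearEquiv.mul_apply, simpleReflection_apply] at hneg
  refine eq_simpleRoot_of_eq_smul hf (hx s) (funext fun r => ?_)
  by_cases hr : r = s
  · simp [hr, simpleRoot_apply_self]
  · have := hneg r
    have := hx r
    simp only [Pi.sub_apply, Pi.smul_apply, simpleRoot_apply_of_ne hr, smul_eq_mul, mul_zero,
      sub_zero, Pi.zero_apply] at *
    exact le_antisymm ‹_› ‹_›

theorem mul_eq_zero_of_combination {f : (B → ℝ) ≃ₗ[ℝ] (B → ℝ)} (hf : f ∈ M.geomRep.range)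
    {x y s t : B} (hxy : x ≠ y) {p q p' q' : ℝ} (hq : 0 ≤ q) (hq' : 0 ≤ q')
    (hx : f (simpleRoot x) = p • simpleRoot t + q • simpleRoot s)
    (hy : f (simpleRoot y) = p' • simpleRoot t + q' • simpleRoot s) : q = 0 ∨ q' = 0 := by
  by_contra! h
  have hqpos := hq.lt_of_ne' h.1
  have hqpos' := hq'.lt_of_ne' h.2
  obtain ⟨β, hβ⟩ : ∃ β, β = f⁻¹ (simpleRoot t) := ⟨_, rfl⟩
  have hsign : 0 ≤ β ∨ β ≤ 0 := hβ ▸ nonneg_or_nonpos_of_mem_range (inv_mem hf) t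
  have hcomb : q' • simpleRoot x - q • simpleRoot y = (q' * p - q * p') • β := by
    apply f.injective
    have hfβ : f β = simpleRoot t := by
      rw [hβ, ← LinearEquiv.mul_apply, mul_inv_cancel]
      rfl
    rw [map_sub, map_smul, map_smul, map_smul, hx, hy, hfβ]
    module
  have h₁ := congrFun hcomb x
  have h₂ := congrFun hcomb y
  simp only [Pi.sub_apply, Pi.smul_apply, smul_eq_mul, simpleRoot_apply_self,
    simpleRoot_apply_of_ne hxy, simpleRoot_apply_of_ne hxy.symm, mul_one, mul_zero, sub_zero,
    zero_sub] at h₁ h₂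
  have hprod : 0 ≤ β x * β y := by
    rcases hsign with h | h
    · exact mul_nonneg (h x) (h y)
    · exact mul_nonneg_of_nonpos_of_nonpos (h x) (h y)
  have := mul_nonneg (sq_nonneg (q' * p - q * p')) hprod
  have := mul_pos hqpos hqpos'
  have : (q' * p - q * p') ^ 2 * (β x * β y) = -(q * q') := by
    linear_combination -((q' * p - q * p') * β y) * h₁ - q' * h₂
  linarith

theorem eq_simpleRoots_of_combination {f : (B → ℝ) ≃ₗ[ℝ] (B → ℝ)} (hf : f ∈ M.geomRep.range)
    {x y s t : B} (hst : s ≠ t) (hxy : x ≠ y) (hx0 : 0 ≤ f (simpleRoot x))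
    (hy0 : 0 ≤ f (simpleRoot y)) {p q p' q' : ℝ}
    (hx : f (simpleRoot x) = p • simpleRoot t + q • simpleRoot s)
    (hy : f (simpleRoot y) = p' • simpleRoot t + q' • simpleRoot s) :
    (f (simpleRoot x) = simpleRoot s ∧ f (simpleRoot y) = simpleRoot t) ∨
      (f (simpleRoot x) = simpleRoot t ∧ f (simpleRoot y) = simpleRoot s) := by
  have hcoeff {v : B → ℝ} (hv : 0 ≤ v) {a b : ℝ} (h : v = a • simpleRoot t + b • simpleRoot s) :
      0 ≤ a ∧ 0 ≤ b := by
    have h₁ := hv t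
    have h₂ := hv s
    simpa [h, simpleRoot_apply_self, simpleRoot_apply_of_ne hst, simpleRoot_apply_of_ne hst.symm]
      using And.intro h₁ h₂
  obtain ⟨hp, hq⟩ := hcoeff hx0 hx
  obtain ⟨hp', hq'⟩ := hcoeff hy0 hy
  have hne (z : B) : f (simpleRoot z) ≠ 0 := by
    simpa using simpleRoot_ne_zero z
  have hqq := mul_eq_zero_of_combination hf hxy hq hq' hx hy
  have hpp := mul_eq_zero_of_combination (s := t) (t := s) hf hxy hp hp'
    (by rw [hx, add_comm]) (by rw [hy, add_comm])
  rcases hqq with rfl | rfl <;> rcases hpp with rfl | rfl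
  · exact absurd (by simpa using hx) (hne x)
  · exact .inr ⟨eq_simpleRoot_of_eq_smul hf hp (by simpa using hx),
      eq_simpleRoot_of_eq_smul hf hq' (by simpa using hy)⟩
  · exact .inl ⟨eq_simpleRoot_of_eq_smul hf hq (by simpa using hx),
      eq_simpleRoot_of_eq_smul hf hp' (by simpa using hy)⟩
  · exact absurd (by simpa using hy) (hne y)

theorem eq_of_cosForm_eq {s t x y : B}
    (h : M.cosForm (simpleRoot x) (simpleRoot y) = M.cosForm (simpleRoot s) (simpleRoot t)) :
    M x y = M s t := by
  have hmem (n : ℕ) : Real.pi / n ∈ Set.Icc 0 Real.pi :=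
    ⟨by positivity, div_nat_le_self_of_nonnneg Real.pi_pos.le n⟩
  rw [cosForm_simpleRoot, cosForm_simpleRoot, neg_inj] at h
  have h' := Real.injOn_cos (hmem _) (hmem _) h
  rw [div_eq_mul_inv, div_eq_mul_inv, mul_right_inj' Real.pi_ne_zero, inv_inj] at h'
  exact_mod_cast h'

theorem simpleReflection_mul_of_apply_eq {f : (B → ℝ) ≃ₗ[ℝ] (B → ℝ)} (hf : f ∈ M.geomRep.range)
    {x s : B} (h : f (simpleRoot x) = simpleRoot s) :
    M.simpleReflection s * f = f * M.simpleReflection x := by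
  ext1 v
  rw [LinearEquiv.mul_apply, LinearEquiv.mul_apply, simpleReflection_apply, ← h,
    M.cosForm_apply_of_mem_range hf, simpleReflection_apply, map_sub, map_smul]

theorem altReflection_mem_range (s t : B) (k : ℕ) : M.altReflection s t k ∈ M.geomRep.range :=
  ⟨_, M.geomRep_alternatingWord s t k⟩

end GeometricRepresentation

section ArtinAction

theorem lift_altFree {B H : Type*} [Group H] (φ : B → H) (s t : B) (m : ℕ) :
    FreeGroup.lift φ (altFree s t m) = ((alternatingWord s t m).map φ).prod := by
  simp [altFree, map_list_prod, Function.comp_def]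

theorem prod_map_agen_comm {B : Type*} {M : CoxeterMatrix B} {s t : B} (hst : s ≠ t) (h0 : M s t ≠ 0) :
    ((alternatingWord s t (M s t)).map (agen M)).prod =
      ((alternatingWord t s (M s t)).map (agen M)).prod := by
  have hmk (s t : B) : PresentedGroup.mk (artinRels M) (altFree s t (M s t)) =
      ((alternatingWord s t (M s t)).map (agen M)).prod := by
    rw [altFree, map_list_prod, List.map_map]
    rfl
  have hrel := PresentedGroup.one_of_mem (rels := artinRels M) ⟨s, t, hst, h0, rfl⟩
  rw [map_mul, map_inv, mul_inv_eq_one, hmk, M.symmetric s t, hmk, ← M.symmetric s t] at hrel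
  exact hrel

variable {B : Type*} [Fintype B] [DecidableEq B] {M : CoxeterMatrix B} {X : Set B}

variable (M X) in
/-- The pairs `(f, g)` with `f` a minimal representative of a left coset of the standard parabolic
subgroup `W_X` (in the geometric representation) and `g` an element of the Artin group. -/
def minCosetPairs : Set (((B → ℝ) ≃ₗ[ℝ] (B → ℝ)) × ArtinGroup M) :=
  {p | p.1 ∈ M.geomRep.range ∧ ∀ x ∈ X, 0 ≤ p.1 (simpleRoot x)}

variable (M X) in
open Classical in
/-- The action of a generator `s`: if `s f = f x` for some `x ∈ X`, then `f` is
fixed and the second component is multiplied by `x`, otherwise `f` is replaced by `s f`. -/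
noncomputable def retractStep (s : B) (p : ((B → ℝ) ≃ₗ[ℝ] (B → ℝ)) × ArtinGroup M) :
    ((B → ℝ) ≃ₗ[ℝ] (B → ℝ)) × ArtinGroup M :=
  if h : ∃ x ∈ X, p.1 (simpleRoot x) = simpleRoot s then (p.1, agen M h.choose * p.2)
  else (M.simpleReflection s * p.1, p.2)

variable (M X) in
open Classical in
/-- The inverse of `retractStep`. -/
noncomputable def retractStepInv (s : B) (p : ((B → ℝ) ≃ₗ[ℝ] (B → ℝ)) × ArtinGroup M) :
    ((B → ℝ) ≃ₗ[ℝ] (B → ℝ)) × ArtinGroup M :=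
  if h : ∃ x ∈ X, p.1 (simpleRoot x) = simpleRoot s then (p.1, (agen M h.choose)⁻¹ * p.2)
  else (M.simpleReflection s * p.1, p.2)

theorem retractStep_of_eq {s x : B} {p : ((B → ℝ) ≃ₗ[ℝ] (B → ℝ)) × ArtinGroup M} (hx : x ∈ X)
    (h : p.1 (simpleRoot x) = simpleRoot s) : M.retractStep X s p = (p.1, agen M x * p.2) := by
  have hex : ∃ x ∈ X, p.1 (simpleRoot x) = simpleRoot s := ⟨x, hx, h⟩
  have : hex.choose = x :=
    simpleRoot_injective (p.1.injective (hex.choose_spec.2.trans h.symm))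
  rw [retractStep, dif_pos hex, this]

theorem retractStep_of_ne {s : B} {p : ((B → ℝ) ≃ₗ[ℝ] (B → ℝ)) × ArtinGroup M}
    (h : ∀ x ∈ X, p.1 (simpleRoot x) ≠ simpleRoot s) :
    M.retractStep X s p = (M.simpleReflection s * p.1, p.2) :=
  dif_neg (by simpa using h)

theorem simpleReflection_mul_mem {s : B} {p : ((B → ℝ) ≃ₗ[ℝ] (B → ℝ)) × ArtinGroup M}
    (hp : p ∈ M.minCosetPairs X) (h : ¬ ∃ x ∈ X, p.1 (simpleRoot x) = simpleRoot s) :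
    (M.simpleReflection s * p.1, p.2) ∈ M.minCosetPairs X :=
  ⟨mul_mem (M.simpleReflection_mem_range s) hp.1, fun x hx =>
    simpleReflection_nonneg hp.1 (hp.2 x hx) fun h' => h ⟨x, hx, h'⟩⟩

theorem not_exists_simpleReflection_mul {s : B} {p : ((B → ℝ) ≃ₗ[ℝ] (B → ℝ)) × ArtinGroup M}
    (hp : p ∈ M.minCosetPairs X) :
    ¬ ∃ x ∈ X, (M.simpleReflection s * p.1) (simpleRoot x) = simpleRoot s := by
  rintro ⟨x, hx, h⟩
  have h' := congrArg (M.simpleReflection s) h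
  rw [← LinearEquiv.mul_apply, ← mul_assoc, simpleReflection_mul_self, one_mul,
    simpleReflection_apply_self] at h'
  have := hp.2 x hx s
  rw [h', Pi.neg_apply, simpleRoot_apply_self] at this
  norm_num at this

theorem retractStep_mem {s : B} {p : ((B → ℝ) ≃ₗ[ℝ] (B → ℝ)) × ArtinGroup M}
    (hp : p ∈ M.minCosetPairs X) : M.retractStep X s p ∈ M.minCosetPairs X := by
  rw [retractStep]
  split_ifs with h
  · exact hp
  · exact simpleReflection_mul_mem hp h

theorem retractStepInv_mem {s : B} {p : ((B → ℝ) ≃ₗ[ℝ] (B → ℝ)) × ArtinGroup M}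
    (hp : p ∈ M.minCosetPairs X) : M.retractStepInv X s p ∈ M.minCosetPairs X := by
  rw [retractStepInv]
  split_ifs with h
  · exact hp
  · exact simpleReflection_mul_mem hp h

theorem retractStepInv_retractStep {s : B} {p : ((B → ℝ) ≃ₗ[ℝ] (B → ℝ)) × ArtinGroup M}
    (hp : p ∈ M.minCosetPairs X) : M.retractStepInv X s (M.retractStep X s p) = p := by
  by_cases h : ∃ x ∈ X, p.1 (simpleRoot x) = simpleRoot s
  · rw [retractStep, dif_pos h]
    exact (dif_pos h).trans (Prod.ext rfl (inv_mul_cancel_left _ _))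
  · rw [retractStep, dif_neg h]
    refine (dif_neg (not_exists_simpleReflection_mul hp)).trans (Prod.ext ?_ rfl)
    rw [← mul_assoc, simpleReflection_mul_self, one_mul]

theorem retractStep_retractStepInv {s : B} {p : ((B → ℝ) ≃ₗ[ℝ] (B → ℝ)) × ArtinGroup M}
    (hp : p ∈ M.minCosetPairs X) : M.retractStep X s (M.retractStepInv X s p) = p := by
  by_cases h : ∃ x ∈ X, p.1 (simpleRoot x) = simpleRoot s
  · rw [retractStepInv, dif_pos h]
    exact (dif_pos h).trans (Prod.ext rfl (mul_inv_cancel_left _ _))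
  · rw [retractStepInv, dif_neg h]
    refine (dif_neg (not_exists_simpleReflection_mul hp)).trans (Prod.ext ?_ rfl)
    rw [← mul_assoc, simpleReflection_mul_self, one_mul]

variable (M X) in
/-- The permutation of `minCosetPairs` given by `retractStep`. -/
noncomputable def retractPerm (s : B) : Equiv.Perm (M.minCosetPairs X) where
  toFun p := ⟨M.retractStep X s p, retractStep_mem p.2⟩
  invFun p := ⟨M.retractStepInv X s p, retractStepInv_mem p.2⟩
  left_inv p := Subtype.ext (retractStepInv_retractStep p.2)
  right_inv p := Subtype.ext (retractStep_retractStepInv p.2)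

theorem coe_prod_retractPerm (l : List B) (p : M.minCosetPairs X) :
    (((l.map (M.retractPerm X)).prod p : M.minCosetPairs X) :
      ((B → ℝ) ≃ₗ[ℝ] (B → ℝ)) × ArtinGroup M) = l.foldr (M.retractStep X) p := by
  induction l with
  | nil => rfl
  | cons s l ih =>
    rw [List.map_cons, List.prod_cons, List.foldr_cons, ← ih]
    rfl

theorem foldr_retractStep_of_forall_ne {s t : B} {p : ((B → ℝ) ≃ₗ[ℝ] (B → ℝ)) × ArtinGroup M}
    {k : ℕ} (h : ∀ j < k, ∀ x ∈ X, p.1 (simpleRoot x) ≠ M.altRoot s t j) :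
    (alternatingWord s t k).foldr (M.retractStep X) p = (M.altReflection s t k * p.1, p.2) := by
  induction k with
  | zero => simp [alternatingWord, altReflection_zero]
  | succ k ih =>
    rw [alternatingWord_succ', List.foldr_cons, ih fun j hj => h j (by lia), retractStep_of_ne,
      altReflection_succ', mul_assoc]
    intro x hx hloop
    rw [LinearEquiv.mul_apply, ← altReflection_altRoot] at hloop
    exact h k k.lt_succ_self x hx ((M.altReflection s t k).injective hloop)

theorem foldr_retractStep_of_exists_eq {s t x : B} (hst : s ≠ t)
    {p : ((B → ℝ) ≃ₗ[ℝ] (B → ℝ)) × ArtinGroup M} (hp : p ∈ M.minCosetPairs X) (hx : x ∈ X)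
    (hunique : ∀ y ∈ X, ∀ a b : ℝ,
      p.1 (simpleRoot y) = a • simpleRoot t + b • simpleRoot s → y = x)
    {k : ℕ} (hk : k ≤ M s t) (h : ∃ j < k, p.1 (simpleRoot x) = M.altRoot s t j) :
    (alternatingWord s t k).foldr (M.retractStep X) p =
      (M.altReflection s t k * p.1 * M.simpleReflection x, agen M x * p.2) := by
  induction k with
  | zero => simp at h
  | succ k ih =>
    rw [alternatingWord_succ', List.foldr_cons, altReflection_succ']
    by_cases hlt : ∃ j < k, p.1 (simpleRoot x) = M.altRoot s t j
    · rw [ih (by lia) hlt, retractStep_of_ne]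
      · simp only [mul_assoc]
      intro y hy hloop
      obtain ⟨j, -, hj⟩ := hlt
      rw [LinearEquiv.mul_apply, LinearEquiv.mul_apply, ← altReflection_altRoot] at hloop
      have hroot := (M.altReflection s t k).injective hloop
      have hyx : y = x := by
        rw [simpleReflection_apply, map_sub, map_smul, hj, sub_eq_iff_eq_add] at hroot
        generalize 2 * M.cosForm (simpleRoot x) (simpleRoot y) = c at hroot
        refine hunique y hy (M.coeff s t (k + 1) + c * M.coeff s t (j + 1))
          (M.coeff s t k + c * M.coeff s t j) ?_
        rw [hroot, altRoot, altRoot]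
        module
      rw [hyx, simpleReflection_apply_self, map_neg] at hroot
      have h0 : p.1 (simpleRoot x) ≤ 0 := by
        rw [← neg_nonneg, hroot]
        exact altRoot_nonneg M hst hk
      have hzero := le_antisymm h0 (hp.2 x hx)
      rw [LinearEquiv.map_eq_zero_iff] at hzero
      exact simpleRoot_ne_zero x hzero
    · have hne : ∀ j < k, ∀ y ∈ X, p.1 (simpleRoot y) ≠ M.altRoot s t j := by
        intro j hj y hy hyj
        obtain rfl := hunique y hy _ _ hyj
        exact hlt ⟨j, hj, hyj⟩
      obtain ⟨j, hj, hxj⟩ := h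
      obtain rfl : j = k := by
        by_contra hjk
        exact hlt ⟨j, by lia, hxj⟩
      have hloop : (M.altReflection s t j * p.1) (simpleRoot x) =
          simpleRoot (if Even j then t else s) := by
        rw [LinearEquiv.mul_apply, hxj, altReflection_altRoot]
      rw [foldr_retractStep_of_forall_ne hne, retractStep_of_eq hx hloop, mul_assoc _ _ p.1,
        simpleReflection_mul_of_apply_eq (mul_mem (M.altReflection_mem_range s t j) hp.1) hloop,
        mul_assoc, simpleReflection_mul_self, mul_one]

theorem foldr_retractStep_of_apply_eq {s t x y : B} {p : ((B → ℝ) ≃ₗ[ℝ] (B → ℝ)) × ArtinGroup M}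
    (hx : x ∈ X) (hy : y ∈ X) (hxs : p.1 (simpleRoot x) = simpleRoot s)
    (hyt : p.1 (simpleRoot y) = simpleRoot t) (k : ℕ) :
    (alternatingWord s t k).foldr (M.retractStep X) p =
      (p.1, ((alternatingWord x y k).map (agen M)).prod * p.2) := by
  induction k with
  | zero => simp [alternatingWord]
  | succ k ih =>
    rw [alternatingWord_succ', List.foldr_cons, ih, alternatingWord_succ', List.map_cons,
      List.prod_cons, mul_assoc]
    split_ifs
    · exact retractStep_of_eq hy hyt
    · exact retractStep_of_eq hx hxs

theorem foldr_retractStep_comm {s t : B} (hst : s ≠ t) (h0 : M s t ≠ 0)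
    {p : ((B → ℝ) ≃ₗ[ℝ] (B → ℝ)) × ArtinGroup M} (hp : p ∈ M.minCosetPairs X) :
    (alternatingWord s t (M s t)).foldr (M.retractStep X) p =
      (alternatingWord t s (M s t)).foldr (M.retractStep X) p := by
  by_cases hdouble : ∃ x ∈ X, ∃ y ∈ X, p.1 (simpleRoot x) = simpleRoot s ∧
      p.1 (simpleRoot y) = simpleRoot t
  · obtain ⟨x, hx, y, hy, hxs, hyt⟩ := hdouble
    have hM : M x y = M s t := eq_of_cosForm_eq (by
      rw [← hxs, ← hyt, M.cosForm_apply_of_mem_range hp.1])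
    have hxy : x ≠ y := by
      rintro rfl
      exact hst (simpleRoot_injective (hxs.symm.trans hyt))
    rw [foldr_retractStep_of_apply_eq hx hy hxs hyt, foldr_retractStep_of_apply_eq hy hx hyt hxs,
      ← hM, prod_map_agen_comm hxy (hM ▸ h0)]
  have hrev {v : B → ℝ} : (∃ j < M s t, v = M.altRoot s t j) ↔
      ∃ j < M t s, v = M.altRoot t s j := by
    rw [M.symmetric t s]
    constructor
    · rintro ⟨j, hj, h⟩
      exact ⟨M s t - 1 - j, by lia, h.trans (altRoot_sub M hst hj).symm⟩
    · rintro ⟨j, hj, h⟩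
      rw [M.symmetric] at hj
      refine ⟨M t s - 1 - j, by rw [M.symmetric t s] at *; lia, h.trans ?_⟩
      exact (altRoot_sub M hst.symm hj).symm
  have hcomm := M.altReflection_comm s t
  by_cases hloop : ∃ x ∈ X, ∃ j < M s t, p.1 (simpleRoot x) = M.altRoot s t j
  · obtain ⟨x, hx, hj⟩ := hloop
    have hunique (y : B) (hy : y ∈ X) (a b : ℝ)
        (hyab : p.1 (simpleRoot y) = a • simpleRoot t + b • simpleRoot s) : y = x := by
      by_contra hyx
      obtain ⟨j, -, hj⟩ := hj
      rcases eq_simpleRoots_of_combination hp.1 hst hyx (hp.2 y hy) (hp.2 x hx) hyab hj with h | h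
      · exact hdouble ⟨y, hy, x, hx, h⟩
      · exact hdouble ⟨x, hx, y, hy, h.symm⟩
    rw [foldr_retractStep_of_exists_eq hst hp hx hunique le_rfl hj,
      foldr_retractStep_of_exists_eq hst.symm hp hx
        (fun y hy a b h => hunique y hy b a (by rw [h, add_comm])) (M.symmetric s t).le
        (by rw [M.symmetric s t]; exact hrev.mp hj), hcomm]
  · have hloop' : ∀ j < M s t, ∀ x ∈ X, p.1 (simpleRoot x) ≠ M.altRoot t s j := by
      intro j hj x hx h
      exact hloop ⟨x, hx, hrev.mpr ⟨j, by rwa [M.symmetric], h⟩⟩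
    push Not at hloop
    rw [foldr_retractStep_of_forall_ne fun j hj x hx => hloop x hx j hj,
      foldr_retractStep_of_forall_ne hloop', hcomm]

variable (M X) in
/-- The action of the Artin group on `minCosetPairs`. -/
noncomputable def artinAction : ArtinGroup M →* Equiv.Perm (M.minCosetPairs X) :=
  PresentedGroup.toGroup (f := M.retractPerm X) (by
    rintro _ ⟨s, t, hst, h0, rfl⟩
    rw [map_mul, map_inv, mul_inv_eq_one, lift_altFree, lift_altFree]
    refine Equiv.ext fun p => Subtype.ext ?_
    rw [coe_prod_retractPerm, coe_prod_retractPerm]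
    exact foldr_retractStep_comm hst h0 p.2)

theorem artinAction_agen (s : B) : M.artinAction X (agen M s) = M.retractPerm X s :=
  PresentedGroup.toGroup.of _

theorem one_mem_minCosetPairs (g : ArtinGroup M) : (1, g) ∈ M.minCosetPairs X :=
  ⟨one_mem _, fun x _ => simpleRoot_nonneg x⟩

theorem artinAction_of_mem_closure {a : ArtinGroup M} (ha : a ∈ Subgroup.closure (agen M '' X))
    (g : ArtinGroup M) :
    M.artinAction X a ⟨(1, g), one_mem_minCosetPairs g⟩ =
      ⟨(1, a * g), one_mem_minCosetPairs (a * g)⟩ := by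
  induction ha using Subgroup.closure_induction generalizing g with
  | mem _ h =>
    obtain ⟨x, hx, rfl⟩ := h
    rw [artinAction_agen]
    exact Subtype.ext (retractStep_of_eq hx rfl)
  | one => simp
  | mul a b _ _ iha ihb => simp only [map_mul, Equiv.Perm.mul_apply, ihb, iha, mul_assoc]
  | inv a _ iha =>
    rw [map_inv, Equiv.Perm.inv_eq_iff_eq, iha]
    simp only [mul_inv_cancel_left]

theorem retractStep_snd_mem (s : B) {p : ((B → ℝ) ≃ₗ[ℝ] (B → ℝ)) × ArtinGroup M}
    (hp : p.2 ∈ Submonoid.closure (agen M '' X)) :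
    (M.retractStep X s p).2 ∈ Submonoid.closure (agen M '' X) := by
  rw [retractStep]
  split_ifs with h
  · exact mul_mem (Submonoid.subset_closure ⟨_, h.choose_spec.1, rfl⟩) hp
  · exact hp

end ArtinAction

end CoxeterMatrix

/-- For a spherical type Artin group `G` and `X ⊆ S`, the intersection of the standard
parabolic subgroup `G_X` with the image `G⁺` of the Artin monoid equals the submonoid
generated by `X`.  Here `π` is the canonical homomorphism from the Artin monoid to the
Artin group (sending each generator to the corresponding generator). -/
theorem stmt5 {B : Type*} [Fintype B] (M : CoxeterMatrix B)
    (hspherical : Finite M.Group)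
    (π : ArtinMonoid M →* ArtinGroup M)
    (hπ : ∀ s : B, π ((artinCon M).mk' (FreeMonoid.of s)) = agen M s)
    (X : Set B) :
    (Subgroup.closure (agen M '' X) : Set (ArtinGroup M)) ∩ Set.range π
      = (Submonoid.closure (agen M '' X) : Set (ArtinGroup M)) := by
  classical
  ext a
  constructor
  · rintro ⟨ha, u, rfl⟩
    have hpos (w : FreeMonoid B) (p : M.minCosetPairs X)
        (hp : p.1.2 ∈ Submonoid.closure (agen M '' X)) :
        (M.artinAction X (π ((artinCon M).mk' w)) p).1.2 ∈ Submonoid.closure (agen M '' X) := by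
      induction w using FreeMonoid.inductionOn' with
      | one => simpa using hp
      | of_mul s w ih =>
        rw [map_mul, map_mul, hπ, map_mul, CoxeterMatrix.artinAction_agen]
        exact CoxeterMatrix.retractStep_snd_mem s ih
    obtain ⟨w, rfl⟩ := Con.mk'_surjective u
    have h := hpos w ⟨(1, 1), CoxeterMatrix.one_mem_minCosetPairs 1⟩ (one_mem _)
    rw [CoxeterMatrix.artinAction_of_mem_closure ha] at h
    simpa using h
  · intro ha
    refine ⟨Subgroup.le_closure_toSubmonoid _ ha, ?_⟩
    have hle : Submonoid.closure (agen M '' X) ≤ MonoidHom.mrange π := by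
      rw [Submonoid.closure_le]
      rintro _ ⟨x, -, rfl⟩
      exact ⟨_, hπ x⟩
    exact hle ha
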